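/- Let f : {0,1}³ → ℂ be not of product type, and suppose ∂^{i}_{[1,0]}(f), ∂^{i}_{[1,1]}(f) and ∂^{i}_{[1,−1]}(f) are of product type for every i ∈ {1,2,3}. Then there exist λ ∈ ℂ and c₁, c₂, c₃ ∈ {1, −1} such that either f(x₁,x₂,x₃) = λ · c₁^{x₁} c₂^{x₂} c₃^{x₃} · [x₁+x₂+x₃ is even] for all (x₁,x₂,x₃) ∈ {0,1}³, or f(x₁,x₂,x₃) = λ · c₁^{x₁} c₂^{x₂} c₃^{x₃} · [x₁+x₂+x₃ is odd] for all (x₁,x₂,x₃) ∈ {0,1}³ (i.e., f is a product of unary functions with the symmetric ternary signature [1,0,1,0] or [0,1,0,1]). -/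

import Mathlib

/-- `h` is in `ℰ`: its support is contained in a pair of antipodal points
`{α, ᾱ}` (over `ℤ₂`, the complement `ᾱ` is `α + 1`). -/
def InE {ι : Type*} (h : (ι → ZMod 2) → ℂ) : Prop :=
  ∃ α : ι → ZMod 2, ∀ x, h x ≠ 0 → x = α ∨ x = α + 1

/-- `f` is of product type (`f ∈ 𝒫`): it factors over a partition of its
variables into signatures from `ℰ`. -/
def IsProductType {ι : Type*} [Fintype ι] [DecidableEq ι]
    (f : (ι → ZMod 2) → ℂ) : Prop :=
  ∃ (k : ℕ) (I : Fin k → Finset ι)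
    (g : (j : Fin k) → ({i // i ∈ I j} → ZMod 2) → ℂ),
    (∀ j, (I j).Nonempty) ∧
    (∀ j j', j ≠ j' → Disjoint (I j) (I j')) ∧
    (∀ i : ι, ∃ j, i ∈ I j) ∧
    (∀ j, InE (g j)) ∧
    ∀ x : ι → ZMod 2, f x = ∏ j, g j (fun i => x i.1)

/-- `∂^{i}_{[a,b]}(f)`: connect the unary signature `[a,b]` to the `i`-th
variable of the ternary signature `f`. -/
def del (f : (Fin 3 → ZMod 2) → ℂ) (i : Fin 3) (a b : ℂ) :
    (Fin 2 → ZMod 2) → ℂ :=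
  fun y => a * f (i.insertNth 0 y) + b * f (i.insertNth 1 y)

open Finset

/-- Product type, with the partition presented as a colouring of the variables and the factors as
functions of all variables that only depend on those of one colour. -/
theorem isProductType_iff_exists_coloring {ι : Type*} [Fintype ι] [DecidableEq ι]
    (f : (ι → ZMod 2) → ℂ) :
    IsProductType f ↔ ∃ (k : ℕ) (c : ι → Fin k) (G : Fin k → (ι → ZMod 2) → ℂ),
      Function.Surjective c ∧
      (∀ j x y, (∀ i, c i = j → x i = y i) → G j x = G j y) ∧
      (∀ j, ∃ α : ι → ZMod 2, ∀ x, G j x ≠ 0 →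
        (∀ i, c i = j → x i = α i) ∨ (∀ i, c i = j → x i = α i + 1)) ∧
      ∀ x, f x = ∏ j, G j x := by
  constructor
  · rintro ⟨k, I, g, hne, hdisj, hcov, hE, hf⟩
    choose c hc using hcov
    have hcI : ∀ i j, i ∈ I j → c i = j := fun i j hij => by
      by_contra hne'
      exact Finset.disjoint_left.mp (hdisj _ _ hne') (hc i) hij
    refine ⟨k, c, fun j x => g j (fun i => x i.1), fun j => ?_, fun j x y hxy => ?_, fun j => ?_, hf⟩
    · obtain ⟨i, hi⟩ := hne j
      exact ⟨i, hcI i j hi⟩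
    · exact congrArg (g j) (funext fun i => hxy i.1 (hcI _ _ i.2))
    · obtain ⟨α, hα⟩ := hE j
      refine ⟨fun i => if h : i ∈ I j then α ⟨i, h⟩ else 0, fun x hx => ?_⟩
      refine (hα _ hx).imp (fun h i hi => ?_) (fun h i hi => ?_)
      all_goals
        have hij : i ∈ I j := hi ▸ hc i
        simpa [hij] using congrFun h ⟨i, hij⟩
  · rintro ⟨k, c, G, hsurj, hloc, hE, hf⟩
    refine ⟨k, fun j => univ.filter (fun i => c i = j),
      fun j y => G j (fun i => if h : c i = j then y ⟨i, by simpa using h⟩ else 0),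
      fun j => ?_, fun j j' hjj => ?_, fun i => ⟨c i, by simp⟩, fun j => ?_, fun x => ?_⟩
    · obtain ⟨i, hi⟩ := hsurj j
      exact ⟨i, by simpa using hi⟩
    · refine Finset.disjoint_left.mpr fun i hi hi' => hjj ?_
      simp only [mem_filter, mem_univ, true_and] at hi hi'
      exact hi.symm.trans hi'
    · obtain ⟨α, hα⟩ := hE j
      refine ⟨fun i => α i.1, fun y hy => ?_⟩
      refine (hα _ hy).imp (fun h => funext fun i => ?_) (fun h => funext fun i => ?_)
      all_goals
        have hi : c i.1 = j := (mem_filter.mp i.2).2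
        simpa [hi] using h i.1 hi
    · rw [hf]
      refine prod_congr rfl fun j _ => hloc j _ _ fun i hi => ?_
      simp [hi]

theorem IsProductType.comp_perm {ι : Type*} [Fintype ι] [DecidableEq ι]
    {f : (ι → ZMod 2) → ℂ} (hf : IsProductType f) (σ : Equiv.Perm ι) :
    IsProductType (fun x => f (x ∘ σ)) := by
  rw [isProductType_iff_exists_coloring] at hf ⊢
  obtain ⟨k, c, G, hsurj, hloc, hE, hf⟩ := hf
  refine ⟨k, c ∘ σ.symm, fun j x => G j (x ∘ σ), hsurj.comp σ.symm.surjective,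
    fun j x y hxy => hloc j _ _ fun i hi => hxy _ (by simpa using hi), fun j => ?_,
    fun x => hf _⟩
  obtain ⟨α, hα⟩ := hE j
  refine ⟨α ∘ σ.symm, fun x hx => (hα _ hx).imp (fun h i hi => ?_) (fun h i hi => ?_)⟩
  all_goals simpa using h (σ.symm i) hi

/-- The binary signatures of product type: singular, diagonal or antidiagonal `2 × 2` matrices. -/
def BinaryProduct (m : ZMod 2 → ZMod 2 → ℂ) : Prop :=
  m 0 0 * m 1 1 = m 0 1 * m 1 0 ∨ (m 0 1 = 0 ∧ m 1 0 = 0) ∨ (m 0 0 = 0 ∧ m 1 1 = 0)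

theorem BinaryProduct.swap {m : ZMod 2 → ZMod 2 → ℂ} (h : BinaryProduct m) :
    BinaryProduct (fun y z => m z y) := by
  exact h.imp (fun h => by rw [h, mul_comm]) (Or.imp_left And.symm)

theorem IsProductType.binaryProduct {g : (Fin 2 → ZMod 2) → ℂ} (hg : IsProductType g) :
    BinaryProduct (fun y z => g ![y, z]) := by
  obtain ⟨k, c, G, -, hloc, hE, hf⟩ := (isProductType_iff_exists_coloring g).mp hg
  by_cases hc : c 0 = c 1
  · right
    obtain ⟨α, hα⟩ := hE (c 0)
    have key : ∀ x, g x ≠ 0 → (x 0 = α 0 ∧ x 1 = α 1) ∨ (x 0 = α 0 + 1 ∧ x 1 = α 1 + 1) := by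
      intro x hx
      rw [hf, prod_ne_zero_iff] at hx
      exact (hα x (hx _ (mem_univ _))).imp (fun h => ⟨h 0 rfl, h 1 hc.symm⟩)
        (fun h => ⟨h 0 rfl, h 1 hc.symm⟩)
    have h00 := key ![0, 0]
    have h01 := key ![0, 1]
    have h10 := key ![1, 0]
    have h11 := key ![1, 1]
    simp only [Matrix.cons_val_zero, Matrix.cons_val_one] at h00 h01 h10 h11
    have parity : ∀ p q : ZMod 2,
        (¬ ((0 = p ∧ 1 = q) ∨ (0 = p + 1 ∧ 1 = q + 1)) ∧
          ¬ ((1 = p ∧ 0 = q) ∨ (1 = p + 1 ∧ 0 = q + 1))) ∨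
        (¬ ((0 = p ∧ 0 = q) ∨ (0 = p + 1 ∧ 0 = q + 1)) ∧
          ¬ ((1 = p ∧ 1 = q) ∨ (1 = p + 1 ∧ 1 = q + 1))) := by decide
    exact (parity (α 0) (α 1)).imp
      (fun h => ⟨not_not.mp (mt h01 h.1), not_not.mp (mt h10 h.2)⟩)
      (fun h => ⟨not_not.mp (mt h00 h.1), not_not.mp (mt h11 h.2)⟩)
  · left
    simp only [hf, ← prod_mul_distrib]
    refine prod_congr rfl fun j _ => ?_
    by_cases hj : c 0 = j
    · have h1 : c 1 ≠ j := fun h => hc (hj.trans h.symm)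
      rw [hloc j ![0, 0] ![0, 1] (by simp [Fin.forall_fin_two, h1]),
        hloc j ![1, 1] ![1, 0] (by simp [Fin.forall_fin_two, h1])]
    · rw [hloc j ![0, 0] ![1, 0] (by simp [Fin.forall_fin_two, hj]),
        hloc j ![1, 1] ![0, 1] (by simp [Fin.forall_fin_two, hj]), mul_comm]

theorem zmod_two_forall {P : ZMod 2 → Prop} : (∀ y, P y) ↔ P 0 ∧ P 1 := Fin.forall_fin_two

theorem exists_eq_mul_of_det_eq_zero {m : ZMod 2 → ZMod 2 → ℂ}
    (h : m 0 0 * m 1 1 = m 0 1 * m 1 0) : ∃ p q : ZMod 2 → ℂ, ∀ y z, m y z = p y * q z := by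
  by_cases h00 : m 0 0 = 0
  · by_cases h01 : m 0 1 = 0
    · refine ⟨Pi.single 1 1, m 1, ?_⟩
      simp [zmod_two_forall, h00, h01]
    · have h10 : m 1 0 = 0 := by simpa [h00, h01] using h
      refine ⟨fun y => m y 1 / m 0 1, m 0, ?_⟩
      simp [zmod_two_forall, h00, h10, div_mul_cancel₀ _ h01]
  · refine ⟨fun y => m y 0 / m 0 0, m 0, ?_⟩
    simp only [zmod_two_forall, div_self h00, div_mul_cancel₀ _ h00, one_mul, true_and]
    rw [div_mul_eq_mul_div, eq_div_iff h00]
    linear_combination h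

theorem exists_common_factor {u w : ZMod 2 → ℂ} (h : u 0 * w 1 = u 1 * w 0) :
    ∃ (r s : ℂ) (q : ZMod 2 → ℂ), (∀ y, u y = r * q y) ∧ ∀ y, w y = s * q y := by
  obtain ⟨p, q, hpq⟩ := exists_eq_mul_of_det_eq_zero (m := fun i y => if i = 0 then u y else w y)
    (by simpa using h)
  exact ⟨p 0, p 1, q, fun y => by simpa using hpq 0 y, fun y => by simpa using hpq 1 y⟩

/-- A ternary signature with separated arguments is of product type. -/
def TernaryProduct (F : ZMod 2 → ZMod 2 → ZMod 2 → ℂ) : Prop :=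
  IsProductType (fun x : Fin 3 → ZMod 2 => F (x 0) (x 1) (x 2))

theorem TernaryProduct.rotate {F : ZMod 2 → ZMod 2 → ZMod 2 → ℂ}
    (h : TernaryProduct (fun x y z => F z x y)) : TernaryProduct F :=
  h.comp_perm (finRotate 3)

theorem ternaryProduct_of_mul {F : ZMod 2 → ZMod 2 → ZMod 2 → ℂ} {u v w : ZMod 2 → ℂ}
    (h : ∀ x y z, F x y z = u x * (v y * w z)) : TernaryProduct F := by
  refine (isProductType_iff_exists_coloring _).mpr ⟨3, id, fun j x => ![u, v, w] j (x j),
    Function.surjective_id, fun j x y hxy => ?_, fun j => ⟨0, fun x _ => ?_⟩, fun x => ?_⟩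
  · exact congrArg (![u, v, w] j) (hxy j rfl)
  · rcases (zmod_two_forall (P := fun t => t = 0 ∨ t = 1)).mpr (by simp) (x j) with hx | hx
    · exact Or.inl fun i hi => by rw [show i = j from hi, hx]; rfl
    · exact Or.inr fun i hi => by rw [show i = j from hi, hx]; rfl
  · simp [Fin.prod_univ_three, h, mul_assoc]

theorem ternaryProduct_of_antipodal {F : ZMod 2 → ZMod 2 → ZMod 2 → ℂ} (α β γ : ZMod 2)
    (h : ∀ x y z, F x y z ≠ 0 →
      (x = α ∧ y = β ∧ z = γ) ∨ (x = α + 1 ∧ y = β + 1 ∧ z = γ + 1)) : TernaryProduct F := by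
  refine (isProductType_iff_exists_coloring _).mpr ⟨1, fun _ => 0, fun _ x => F (x 0) (x 1) (x 2),
    fun j => ⟨0, Subsingleton.elim _ _⟩, fun j x y hxy => ?_, fun j => ⟨![α, β, γ], fun x hx => ?_⟩,
    fun x => ?_⟩
  · simp [hxy _ (Subsingleton.elim _ _)]
  · simpa [Fin.forall_fin_succ, Subsingleton.elim j 0] using h _ _ _ hx
  · simp

theorem ternaryProduct_of_mul_binary {F : ZMod 2 → ZMod 2 → ZMod 2 → ℂ} {u : ZMod 2 → ℂ}
    {m : ZMod 2 → ZMod 2 → ℂ} (β : ZMod 2)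
    (hm : ∀ y z, m y z ≠ 0 → z = y + β) (h : ∀ x y z, F x y z = u x * m y z) :
    TernaryProduct F := by
  refine (isProductType_iff_exists_coloring _).mpr ⟨2, ![0, 1, 1],
    ![fun x => u (x 0), fun x => m (x 1) (x 2)], ?_, ?_, ?_, fun x => ?_⟩
  · decide
  · simp +contextual [Fin.forall_fin_succ]
  · have dich : ∀ s t : ZMod 2, s = t ∨ s = t + 1 := by decide
    refine Fin.forall_fin_two.mpr ⟨⟨0, fun x _ => ?_⟩, ⟨![0, 0, β], fun x hx => ?_⟩⟩
    · simpa [Fin.forall_fin_succ] using dich (x 0) 0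
    · have hz := hm _ _ hx
      rcases dich (x 1) 0 with h1 | h1
      · left
        simp [Fin.forall_fin_succ, h1, hz]
      · right
        simp [Fin.forall_fin_succ, h1, hz, add_comm]
  · simp [Fin.prod_univ_two, h]

theorem ternaryProduct_of_mul_binaryProduct {F : ZMod 2 → ZMod 2 → ZMod 2 → ℂ} {u : ZMod 2 → ℂ}
    {m : ZMod 2 → ZMod 2 → ℂ} (hm : BinaryProduct m) (h : ∀ x y z, F x y z = u x * m y z) :
    TernaryProduct F := by
  rcases hm with hm | hm | hm
  · obtain ⟨p, q, hpq⟩ := exists_eq_mul_of_det_eq_zero hm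
    exact ternaryProduct_of_mul (fun x y z => by rw [h, hpq])
  · exact ternaryProduct_of_mul_binary 0 (by simp [zmod_two_forall, hm.1, hm.2]) h
  · refine ternaryProduct_of_mul_binary 1 ?_ h
    simp only [zmod_two_forall, hm.1, hm.2]
    refine ⟨⟨by simp, fun _ => by decide⟩, ⟨fun _ => by decide, by simp⟩⟩

theorem BinaryProduct.of_const_mul {m : ZMod 2 → ZMod 2 → ℂ} {c : ℂ} (hc : c ≠ 0)
    (h : BinaryProduct (fun y z => c * m y z)) : BinaryProduct m := by
  unfold BinaryProduct at *
  simp only [mul_eq_zero, hc, false_or] at h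
  refine h.imp_left fun h => mul_left_cancel₀ (mul_ne_zero hc hc) ?_
  linear_combination h

/-- Connecting `[1, 0]`, `[1, 1]` or `[1, -1]` to the first variable gives product type. -/
structure FirstDerivatives (F : ZMod 2 → ZMod 2 → ZMod 2 → ℂ) : Prop where
  zero : BinaryProduct (F 0)
  add : BinaryProduct (fun y z => F 0 y z + F 1 y z)
  sub : BinaryProduct (fun y z => F 0 y z - F 1 y z)

/-- The hypotheses of the theorem, for a signature with separated arguments. -/
structure Admissible (F : ZMod 2 → ZMod 2 → ZMod 2 → ℂ) : Prop where
  first : FirstDerivatives F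
  second : FirstDerivatives (fun y z x => F x y z)
  third : FirstDerivatives (fun z x y => F x y z)
  not_product : ¬ TernaryProduct F

theorem Admissible.rotate {F : ZMod 2 → ZMod 2 → ZMod 2 → ℂ} (h : Admissible F) :
    Admissible (fun x y z => F z x y) :=
  ⟨h.second, h.third, h.first, fun hT => h.not_product hT.rotate⟩

/-- A unary factor on the first variable is impossible. -/
theorem Admissible.ne_mul {F : ZMod 2 → ZMod 2 → ZMod 2 → ℂ} (hF : Admissible F)
    {u : ZMod 2 → ℂ} {m : ZMod 2 → ZMod 2 → ℂ} (h : ∀ x y z, F x y z = u x * m y z) : False := by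
  apply hF.not_product
  by_cases h1 : u 0 + u 1 = 0
  · by_cases h2 : u 0 - u 1 = 0
    · have hu : ∀ x, u x = 0 := zmod_two_forall.mpr
        ⟨by linear_combination (h1 + h2) / 2, by linear_combination (h1 - h2) / 2⟩
      exact ternaryProduct_of_mul_binaryProduct (u := 0) (m := 0) (by simp [BinaryProduct])
        (by simp [h, hu])
    · refine ternaryProduct_of_mul_binaryProduct (BinaryProduct.of_const_mul h2 ?_) h
      simpa only [h, ← sub_mul] using hF.first.sub
  · refine ternaryProduct_of_mul_binaryProduct (BinaryProduct.of_const_mul h1 ?_) h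
    simpa only [h, ← add_mul] using hF.first.add

/-- The pencil spanned by the two halves of the signature contains a nonsingular member among
the three that are tested. -/
theorem Admissible.exists_det_ne_zero {F : ZMod 2 → ZMod 2 → ZMod 2 → ℂ} (hF : Admissible F)
    (h0 : F 0 0 0 * F 0 1 1 = F 0 0 1 * F 0 1 0) :
    (F 0 0 0 + F 1 0 0) * (F 0 1 1 + F 1 1 1) ≠ (F 0 0 1 + F 1 0 1) * (F 0 1 0 + F 1 1 0) ∨
    (F 0 0 0 - F 1 0 0) * (F 0 1 1 - F 1 1 1) ≠ (F 0 0 1 - F 1 0 1) * (F 0 1 0 - F 1 1 0) := by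
  by_contra! hcon
  obtain ⟨hp, hm⟩ := hcon
  have h1 : F 1 0 0 * F 1 1 1 = F 1 0 1 * F 1 1 0 := by
    linear_combination (hp + hm) / 2 - h0
  obtain ⟨u, v, huv⟩ := exists_eq_mul_of_det_eq_zero h0
  obtain ⟨w, t, hwt⟩ := exists_eq_mul_of_det_eq_zero h1
  have key : (u 0 * w 1 - u 1 * w 0) * (v 0 * t 1 - v 1 * t 0) = 0 := by
    simp only [huv, hwt] at hp hm
    linear_combination (hp - hm) / 2
  rcases mul_eq_zero.mp key with hk | hk
  · obtain ⟨r, s, q, hu, hw⟩ := exists_common_factor (sub_eq_zero.mp hk)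
    refine hF.rotate.ne_mul (u := q) (m := fun z x => if x = 0 then r * v z else s * t z)
      fun y z => zmod_two_forall.mpr ⟨?_, ?_⟩
    · simp only [huv, hu, if_true]
      ring
    · simp only [hwt, hw, one_ne_zero, if_false]
      ring
  · obtain ⟨r, s, q, hv, ht⟩ := exists_common_factor (sub_eq_zero.mp hk)
    refine hF.rotate.rotate.ne_mul (u := q) (m := fun x y => if x = 0 then r * u y else s * w y)
      fun z => zmod_two_forall.mpr ⟨fun y => ?_, fun y => ?_⟩
    · simp only [huv, hv, if_true]
      ring
    · simp only [hwt, ht, one_ne_zero, if_false]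
      ring

theorem Admissible.not_diagonal {F : ZMod 2 → ZMod 2 → ZMod 2 → ℂ} (hF : Admissible F)
    (h001 : F 0 0 1 = 0) (h010 : F 0 1 0 = 0) (h101 : F 1 0 1 = 0) (h110 : F 1 1 0 = 0)
    (h : F 0 0 0 * F 1 1 1 = F 0 1 1 * F 1 0 0) : False := by
  obtain ⟨p, q, hpq⟩ := exists_eq_mul_of_det_eq_zero (m := fun x y => F x y y) h
  refine hF.ne_mul (u := p) (m := fun y z => if z = y then q y else 0) ?_
  simp [zmod_two_forall, h001, h010, h101, h110, ← hpq]

theorem Admissible.not_antidiagonal {F : ZMod 2 → ZMod 2 → ZMod 2 → ℂ} (hF : Admissible F)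
    (h000 : F 0 0 0 = 0) (h011 : F 0 1 1 = 0) (h100 : F 1 0 0 = 0) (h111 : F 1 1 1 = 0)
    (h : F 0 0 1 * F 1 1 0 = F 0 1 0 * F 1 0 1) : False := by
  obtain ⟨p, q, hpq⟩ := exists_eq_mul_of_det_eq_zero
    (m := fun x y => if y = 0 then F x 0 1 else F x 1 0) (by simpa using h)
  simp only [zmod_two_forall, if_true, one_ne_zero, if_false] at hpq
  refine hF.ne_mul (u := p) (m := fun y z => if z = y then 0 else q y) ?_
  simp [zmod_two_forall, *]

/-- A parity signature whose nonzero values agree up to sign, described by equations. -/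
def SignedParity (F : ZMod 2 → ZMod 2 → ZMod 2 → ℂ) : Prop :=
  ((F 0 0 0 ≠ 0 ∧ F 0 1 1 ≠ 0 ∧ F 1 0 1 ≠ 0 ∧ F 1 1 0 ≠ 0) ∧
    (F 0 0 1 = 0 ∧ F 0 1 0 = 0 ∧ F 1 0 0 = 0 ∧ F 1 1 1 = 0) ∧
    F 0 0 0 * F 0 1 1 = F 1 0 1 * F 1 1 0 ∧ F 0 0 0 * F 1 0 1 = F 1 1 0 * F 0 1 1 ∧
    F 0 0 0 * F 1 1 0 = F 0 1 1 * F 1 0 1) ∨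
  ((F 1 1 1 ≠ 0 ∧ F 1 0 0 ≠ 0 ∧ F 0 1 0 ≠ 0 ∧ F 0 0 1 ≠ 0) ∧
    (F 0 1 1 = 0 ∧ F 1 0 1 = 0 ∧ F 1 1 0 = 0 ∧ F 0 0 0 = 0) ∧
    F 1 1 1 * F 1 0 0 = F 0 1 0 * F 0 0 1 ∧ F 1 1 1 * F 0 1 0 = F 0 0 1 * F 1 0 0 ∧
    F 1 1 1 * F 0 0 1 = F 1 0 0 * F 0 1 0)

theorem SignedParity.rotate {F : ZMod 2 → ZMod 2 → ZMod 2 → ℂ}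
    (h : SignedParity (fun x y z => F z x y)) : SignedParity F := by
  unfold SignedParity at *
  tauto

/-- Solving the equations of `SignedParity` for one parity class. -/
theorem exists_signs {a d g h : ℂ} (ha : a ≠ 0) (hg : g ≠ 0) (hh : h ≠ 0)
    (h1 : a * d = g * h) (h2 : a * g = h * d) (h3 : a * h = d * g) :
    ∃ s t : ℂ, (s = 1 ∨ s = -1) ∧ (t = 1 ∨ t = -1) ∧ d = a * s ∧ g = a * t ∧ h = a * s * t := by
  have sign_of_sq : ∀ {q : ℂ}, q * q = a * a → ∃ s : ℂ, (s = 1 ∨ s = -1) ∧ q = a * s := by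
    intro q h
    rcases mul_self_eq_mul_self_iff.mp h with h | h
    · exact ⟨1, Or.inl rfl, by rw [h, mul_one]⟩
    · exact ⟨-1, Or.inr rfl, by rw [h, mul_neg_one]⟩
  have hdd : d * d = a * a := mul_left_cancel₀ (mul_ne_zero hg hh) <| by
    linear_combination -(a * h) * h2 - h * d * h3
  have hgg : g * g = a * a := mul_left_cancel₀ (mul_ne_zero ha hh) <| by
    linear_combination -g * a * h1 - a * a * h3
  obtain ⟨s, hs, rfl⟩ := sign_of_sq hdd
  obtain ⟨t, ht, rfl⟩ := sign_of_sq hgg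
  exact ⟨s, t, hs, ht, rfl, rfl, mul_left_cancel₀ ha (by linear_combination h3)⟩

theorem Admissible.signedParity_of_det_ne_zero {F : ZMod 2 → ZMod 2 → ZMod 2 → ℂ}
    (hF : Admissible F) (hdet : F 0 0 0 * F 0 1 1 ≠ F 0 0 1 * F 0 1 0) : SignedParity F := by
  have h1 := hF.first
  have h2 := hF.second
  have h3 := hF.third
  have nd := hF.not_diagonal
  have na := hF.not_antidiagonal
  obtain ⟨z1, p1, m1⟩ := h1
  obtain ⟨z2, p2, m2⟩ := h2
  obtain ⟨z3, p3, m3⟩ := h3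
  unfold SignedParity
  unfold BinaryProduct at *
  dsimp only at *
  generalize F 0 0 0 = a at *
  generalize F 0 0 1 = b at *
  generalize F 0 1 0 = c at *
  generalize F 0 1 1 = d at *
  generalize F 1 0 0 = e at *
  generalize F 1 0 1 = g at *
  generalize F 1 1 0 = h at *
  generalize F 1 1 1 = k at *
  rcases z1 with z1 | ⟨rfl, rfl⟩ | ⟨rfl, rfl⟩
  · exact absurd z1 hdet
  · left
    obtain ⟨ha, hd⟩ : a ≠ 0 ∧ d ≠ 0 := by simpa using hdet
    have hge : g = 0 ∨ e = 0 := by simpa [ha, or_comm, and_comm] using z2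
    have hhe : h = 0 ∨ e = 0 := by simpa [ha, or_comm, and_comm] using z3
    have hgh : ¬ (g = 0 ∧ h = 0) := by
      rintro ⟨rfl, rfl⟩
      simp [ha, hd] at p2
      exact nd rfl rfl rfl rfl (by linear_combination p2)
    obtain rfl : e = 0 := by
      by_contra he
      exact hgh ⟨hge.resolve_right he, hhe.resolve_right he⟩
    simp [ha, hgh] at p1 m1
    have hk : k = 0 := by
      have : a * k = 0 := by linear_combination (p1 - m1) / 2
      simpa [ha] using this
    subst hk
    have hgh0 : g * h ≠ 0 := by
      rw [← p1]
      simp [ha, hd]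
    obtain ⟨hg, hh⟩ := mul_ne_zero_iff.mp hgh0
    simp [ha, hd, hg, hh] at p2 p3
    refine ⟨⟨ha, hd, hg, hh⟩, ⟨rfl, rfl, rfl, rfl⟩, ?_, ?_, ?_⟩
    · linear_combination p1
    · linear_combination p2
    · linear_combination p3
  · right
    obtain ⟨hb, hc⟩ : b ≠ 0 ∧ c ≠ 0 := by simpa [eq_comm] using hdet
    have hge : g = 0 ∨ e = 0 := by simpa [hb, or_comm, and_comm] using z2
    have hhe : h = 0 ∨ e = 0 := by simpa [hc, or_comm, and_comm] using z3
    by_cases he : e = 0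
    · subst he
      exfalso
      simp [hb, hc] at p2 m2
      have hk : k = 0 := by
        have : c * k = 0 := by linear_combination (p2 - m2) / 2
        simpa [hc] using this
      subst hk
      exact na rfl rfl rfl rfl (by linear_combination -p2)
    · obtain rfl : g = 0 := hge.resolve_right he
      obtain rfl : h = 0 := hhe.resolve_right he
      simp [hb, hc, he] at p1 p2 p3
      have hk : k ≠ 0 := by
        rintro rfl
        simp [hb, hc, eq_comm] at p1
      refine ⟨⟨hk, he, hc, hb⟩, ⟨rfl, rfl, rfl, rfl⟩, ?_, ?_, ?_⟩
      · linear_combination p1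
      · linear_combination p2
      · linear_combination p3

theorem Admissible.not_antipodal {F : ZMod 2 → ZMod 2 → ZMod 2 → ℂ} (hF : Admissible F) :
    ¬ (F 0 0 1 = 0 ∧ F 0 1 0 = 0 ∧ F 0 1 1 = 0 ∧ F 1 0 0 = 0 ∧ F 1 0 1 = 0 ∧ F 1 1 0 = 0) ∧
    ¬ (F 0 0 0 = 0 ∧ F 0 1 0 = 0 ∧ F 0 1 1 = 0 ∧ F 1 0 0 = 0 ∧ F 1 0 1 = 0 ∧ F 1 1 1 = 0) ∧
    ¬ (F 0 0 0 = 0 ∧ F 0 0 1 = 0 ∧ F 0 1 1 = 0 ∧ F 1 0 0 = 0 ∧ F 1 1 0 = 0 ∧ F 1 1 1 = 0) ∧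
    ¬ (F 0 0 0 = 0 ∧ F 0 0 1 = 0 ∧ F 0 1 0 = 0 ∧ F 1 0 1 = 0 ∧ F 1 1 0 = 0 ∧ F 1 1 1 = 0) := by
  have one_add : (1 : ZMod 2) + 1 = 0 := rfl
  refine ⟨fun h => ?_, fun h => ?_, fun h => ?_, fun h => ?_⟩
  · exact hF.not_product (ternaryProduct_of_antipodal 0 0 0 (by simp [zmod_two_forall, h]))
  · exact hF.not_product (ternaryProduct_of_antipodal 0 0 1
      (by simp [zmod_two_forall, h, one_add]))
  · exact hF.not_product (ternaryProduct_of_antipodal 0 1 0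
      (by simp [zmod_two_forall, h, one_add]))
  · exact hF.not_product (ternaryProduct_of_antipodal 0 1 1
      (by simp [zmod_two_forall, h, one_add]))

/-- If all halves at `0` are singular, then so are the other members of the pencil. -/
theorem Admissible.pencil_det_eq_zero {F : ZMod 2 → ZMod 2 → ZMod 2 → ℂ} (hF : Admissible F)
    (d1 : F 0 0 0 * F 0 1 1 = F 0 0 1 * F 0 1 0) (d2 : F 0 0 0 * F 1 0 1 = F 0 0 1 * F 1 0 0)
    (d3 : F 0 0 0 * F 1 1 0 = F 0 1 0 * F 1 0 0) {s : ℂ} (hs : s * s = 1)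
    (p1 : BinaryProduct (fun y z => F 0 y z + s * F 1 y z))
    (m1 : BinaryProduct (fun y z => F 0 y z - s * F 1 y z)) :
    (F 0 0 0 + s * F 1 0 0) * (F 0 1 1 + s * F 1 1 1) =
      (F 0 0 1 + s * F 1 0 1) * (F 0 1 0 + s * F 1 1 0) := by
  by_contra hdet
  have nd := hF.not_diagonal
  have na := hF.not_antidiagonal
  obtain ⟨n1, n2, n3, n4⟩ := hF.not_antipodal
  obtain ⟨-, p2, m2⟩ := hF.second
  obtain ⟨-, p3, m3⟩ := hF.third
  unfold BinaryProduct at *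
  dsimp only at *
  generalize F 0 0 0 = a at *
  generalize F 0 0 1 = b at *
  generalize F 0 1 0 = c at *
  generalize F 0 1 1 = d at *
  generalize F 1 0 0 = e at *
  generalize F 1 0 1 = g at *
  generalize F 1 1 0 = h at *
  generalize F 1 1 1 = k at *
  have hs0 : s ≠ 0 := left_ne_zero_of_mul_eq_one hs
  rcases p1 with p1 | ⟨hbg, hch⟩ | ⟨hae, hdk⟩
  · exact hdet p1
  · obtain ⟨hae, hdk⟩ : a + s * e ≠ 0 ∧ d + s * k ≠ 0 := by simpa [hbg] using hdet
    have hb : (a + s * e) * b = 0 := by linear_combination a * hbg - s * d2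
    have hc : (a + s * e) * c = 0 := by linear_combination a * hch - s * d3
    obtain rfl : b = 0 := by simpa [hae] using hb
    obtain rfl : c = 0 := by simpa [hae] using hc
    obtain rfl : g = 0 := by simpa [hs0] using hbg
    obtain rfl : h = 0 := by simpa [hs0] using hch
    simp at p2 n1 n4
    rcases p2 with p2 | ⟨rfl, rfl⟩ | ⟨rfl, rfl⟩
    · exact nd rfl rfl rfl rfl (by linear_combination p2)
    · simp at n1
    · simp at n4
  · obtain ⟨hbg, hch⟩ : b + s * g ≠ 0 ∧ c + s * h ≠ 0 := by simpa [hae, eq_comm] using hdet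
    have ha : (b + s * g) * a = 0 := by linear_combination b * hae + s * d2
    obtain rfl : a = 0 := by simpa [hbg] using ha
    obtain rfl : e = 0 := by simpa [hs0] using hae
    obtain rfl : k = -s * d := by linear_combination s * hdk - k * hs
    have hbc : b = 0 ∨ c = 0 := by simpa [eq_comm] using d1
    by_cases hd : d = 0
    · subst hd
      simp at p2 n2 n3 na
      rcases p2 with p2 | ⟨rfl, rfl⟩ | ⟨rfl, rfl⟩
      · exact na (by linear_combination -p2)
      · simp at n3
      · simp at n2
    · have hm : b - s * g = 0 ∨ c - s * h = 0 := by
        rcases m1 with m1 | m1 | m1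
        · simpa [eq_comm] using m1
        · exact Or.inl m1.1
        · have : d = 0 := by linear_combination m1.2 / 2 - d / 2 * hs
          contradiction
      rcases hm with hm | hm
      · have hb : b ≠ 0 := by
          rintro rfl
          exact hbg (by linear_combination -hm)
        obtain rfl : c = 0 := hbc.resolve_left hb
        obtain rfl : g = s * b := by linear_combination -s * hm - g * hs
        simp [hb, hd] at p3 m3
        have : b * d = 0 := by linear_combination -(s / 4) * (p3 + m3) - b * d * hs
        simp [hb, hd] at this
      · have hc : c ≠ 0 := by
          rintro rfl
          exact hch (by linear_combination -hm)
        obtain rfl : b = 0 := hbc.resolve_right hc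
        obtain rfl : h = s * c := by linear_combination -s * hm - h * hs
        simp [hc, hd] at p2 m2
        have : c * d = 0 := by linear_combination -(s / 4) * (p2 + m2) - c * d * hs
        simp [hc, hd] at this

theorem Admissible.signedParity {F : ZMod 2 → ZMod 2 → ZMod 2 → ℂ} (hF : Admissible F) :
    SignedParity F := by
  by_cases d1 : F 0 0 0 * F 0 1 1 = F 0 0 1 * F 0 1 0
  · by_cases d2 : F 0 0 0 * F 1 0 1 = F 0 0 1 * F 1 0 0
    · by_cases d3 : F 0 0 0 * F 1 1 0 = F 0 1 0 * F 1 0 0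
      · have hp := hF.pencil_det_eq_zero d1 d2 d3 (s := 1) (by norm_num)
          (by simpa using hF.first.add) (by simpa using hF.first.sub)
        have hm := hF.pencil_det_eq_zero d1 d2 d3 (s := -1) (by norm_num)
          (by simpa [← sub_eq_add_neg] using hF.first.sub) (by simpa using hF.first.add)
        rcases hF.exists_det_ne_zero d1 with h | h
        · exact absurd (by linear_combination hp) h
        · exact absurd (by linear_combination hm) h
      · refine (hF.rotate.rotate.signedParity_of_det_ne_zero ?_).rotate.rotate
        exact fun h => d3 (by linear_combination h)
    · refine (hF.rotate.signedParity_of_det_ne_zero ?_).rotate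
      exact fun h => d2 (by linear_combination h)
  · exact hF.signedParity_of_det_ne_zero d1

theorem IsProductType.binaryProduct_del {f : (Fin 3 → ZMod 2) → ℂ} {i : Fin 3} {a b : ℂ}
    (h : IsProductType (del f i a b)) :
    BinaryProduct (fun y z => a * f (i.insertNth 0 ![y, z]) + b * f (i.insertNth 1 ![y, z])) :=
  h.binaryProduct

theorem admissible_of_del {f : (Fin 3 → ZMod 2) → ℂ} (hf : ¬ IsProductType f)
    (hprod : ∀ i : Fin 3,
      IsProductType (del f i 1 0) ∧ IsProductType (del f i 1 1) ∧
        IsProductType (del f i 1 (-1))) :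
    Admissible (fun x y z => f ![x, y, z]) := by
  have e0 : ∀ x y z : ZMod 2, (0 : Fin 3).insertNth x ![y, z] = ![x, y, z] := by decide
  have e1 : ∀ x y z : ZMod 2, (1 : Fin 3).insertNth y ![x, z] = ![x, y, z] := by decide
  have e2 : ∀ x y z : ZMod 2, (2 : Fin 3).insertNth z ![x, y] = ![x, y, z] := by decide
  have first : ∀ i : Fin 3, ∀ F : ZMod 2 → ZMod 2 → ZMod 2 → ℂ,
      (∀ x y z, F x y z = f (i.insertNth x ![y, z])) → FirstDerivatives F := by
    intro i F hF
    obtain ⟨h1, h2, h3⟩ := hprod i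
    refine ⟨?_, ?_, ?_⟩
    · simpa [← hF] using h1.binaryProduct_del
    · simpa [← hF] using h2.binaryProduct_del
    · simpa [← hF, ← sub_eq_add_neg] using h3.binaryProduct_del
  have swap : ∀ {F : ZMod 2 → ZMod 2 → ZMod 2 → ℂ}, FirstDerivatives F →
      FirstDerivatives (fun x y z => F x z y) :=
    fun h => ⟨h.zero.swap, h.add.swap, h.sub.swap⟩
  refine ⟨first 0 _ fun x y z => by rw [e0], ?_, first 2 _ fun z x y => by rw [e2], ?_⟩
  · exact swap (first 1 (fun y x z => f ![x, y, z]) fun y x z => by rw [e1])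
  · intro hT
    have hx : ∀ x : Fin 3 → ZMod 2, ![x 0, x 1, x 2] = x := by decide
    exact hf (by simpa only [TernaryProduct, hx] using hT)

/-- `[1,0,1,0]` (resp. `[0,1,0,1]`) is expressed by the even
(resp. odd) parity indicator on `x₁+x₂+x₃`, and `cᵢ^{xᵢ}` by `cᵢ ^ (x i).val`. -/
theorem product_with_parity_signature
    (f : (Fin 3 → ZMod 2) → ℂ) (hf : ¬ IsProductType f)
    (hprod : ∀ i : Fin 3,
      IsProductType (del f i 1 0) ∧ IsProductType (del f i 1 1) ∧
        IsProductType (del f i 1 (-1))) :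
    ∃ lam c₁ c₂ c₃ : ℂ,
      (c₁ = 1 ∨ c₁ = -1) ∧ (c₂ = 1 ∨ c₂ = -1) ∧ (c₃ = 1 ∨ c₃ = -1) ∧
      ((∀ x : Fin 3 → ZMod 2,
          f x = lam * c₁ ^ (x 0).val * c₂ ^ (x 1).val * c₃ ^ (x 2).val *
            (if Even ((x 0).val + (x 1).val + (x 2).val) then 1 else 0)) ∨
       (∀ x : Fin 3 → ZMod 2,
          f x = lam * c₁ ^ (x 0).val * c₂ ^ (x 1).val * c₃ ^ (x 2).val *
            (if Odd ((x 0).val + (x 1).val + (x 2).val) then 1 else 0))) := by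
  have hx : ∀ x : Fin 3 → ZMod 2, ![x 0, x 1, x 2] = x := by decide
  have forall_iff : ∀ g : (Fin 3 → ZMod 2) → ℂ, (∀ x, f x = g x) ↔
      ∀ x y z, f ![x, y, z] = g ![x, y, z] := fun g =>
    ⟨fun h x y z => h _, fun h x => by simpa only [hx] using h (x 0) (x 1) (x 2)⟩
  have val_one : (1 : ZMod 2).val = 1 := rfl
  rcases (admissible_of_del hf hprod).signedParity with
    ⟨⟨ha, -, hg, hh⟩, ⟨h001, h010, h100, h111⟩, h1, h2, h3⟩ |
    ⟨⟨hk, he, hc, hb⟩, ⟨h011, h101, h110, h000⟩, h1, h2, h3⟩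
  · dsimp only at *
    obtain ⟨s, t, hs, ht, hd, hg, hh⟩ := exists_signs ha hg hh h1 h2 h3
    refine ⟨f ![0, 0, 0], t, s, 1, ht, hs, Or.inl rfl, Or.inl ((forall_iff _).mpr ?_)⟩
    simp [zmod_two_forall, val_one, h001, h010, h100, h111, hd, hg, hh, Nat.even_iff]
    ring
  · dsimp only at *
    obtain ⟨s, t, hs, ht, hc, he, hk⟩ := exists_signs (d := f ![0, 1, 0]) hb he hk
      (by linear_combination -h1) (by linear_combination -h2) (by linear_combination h3)
    refine ⟨f ![0, 0, 1], t, s, 1, ht, hs, Or.inl rfl, Or.inr ((forall_iff _).mpr ?_)⟩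
    simp [zmod_two_forall, val_one, h011, h101, h110, h000, hc, he, hk, Nat.odd_iff]
    ring
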